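/- Let p and q be probability distributions on ℕ×ℕ with ∑_{i,j} i·p(i,j) ≤ t_p and ∑_{i,j} i·q(i,j) ≤ t_q for some t_p, t_q > 0. Then for every ε ∈ (0,1] with TV(p,q) ≤ ε one has −( ε·g(t_q/ε) + g(ε) ) ≤ H(X₁|X₂)_p − H(X₁|X₂)_q ≤ ε·g(t_p/ε) + g(ε). -/

import Mathlib

open scoped ENNReal

/-- `p` is a probability distribution on `α`: nonnegative entries summing to `1`. -/
def IsProbDist {α : Type*} (p : α → ℝ) : Prop := (∀ x, 0 ≤ p x) ∧ HasSum p 1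

/-- Extended-real-valued Shannon entropy `H(r) = ∑ η(r i) ∈ [0,+∞]`,
where `η(x) = −x ln x`. -/
noncomputable def shEnt (r : ℕ → ℝ) : ℝ≥0∞ :=
  ∑' i, ENNReal.ofReal (Real.negMulLog (r i))

/-- Total variation distance `TV(p,q) = (1/2)·∑ |p x − q x|`. -/
noncomputable def TVd {α : Type*} (p q : α → ℝ) : ℝ := (1 / 2) * ∑' x, |p x - q x|

/-- `g(x) = (x+1)·ln(x+1) − x·ln x` (with `g(0) = 0`, as `Real.log 0 = 0`). -/
noncomputable def gFun (x : ℝ) : ℝ := (x + 1) * Real.log (x + 1) - x * Real.log x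

/-- First marginal `p₁(i) = ∑_j p(i,j)`. -/
noncomputable def marg1 (p : ℕ × ℕ → ℝ) (i : ℕ) : ℝ := ∑' j, p (i, j)

/-- Second marginal `p₂(j) = ∑_i p(i,j)`. -/
noncomputable def marg2 (p : ℕ × ℕ → ℝ) (j : ℕ) : ℝ := ∑' i, p (i, j)

/-- Conditional Shannon entropy
`H(X₁|X₂)_p = ∑_{j : p₂(j) > 0} p₂(j)·H(p(·|j)) ∈ [0,+∞]`
(terms with `p₂(j) = 0` contribute `0`, since `0·∞ = 0` in `ℝ≥0∞` and division
by zero gives the zero distribution). -/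
noncomputable def condEnt (p : ℕ × ℕ → ℝ) : ℝ≥0∞ :=
  ∑' j, ENNReal.ofReal (marg2 p j) * shEnt fun i => p (i, j) / marg2 p j

/-- The perspective `x * log (y / x)` is monotone along increments `(r, u)` with `r ≤ u`. -/
lemma mul_log_div_le_mul_log_div {x y X Y : ℝ} (hx : 0 ≤ x) (hxX : x ≤ X) (hxy : x ≤ y)
    (h : y - x ≤ Y - X) : x * Real.log (y / x) ≤ X * Real.log (Y / X) := by
  have hXY : X ≤ Y := by linarith
  rcases hx.eq_or_lt with rfl | hx
  · rcases hxX.eq_or_lt with rfl | hX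
    · simp
    · simpa using mul_nonneg hX.le (Real.log_nonneg ((one_le_div hX).2 hXY))
  have hX : 0 < X := hx.trans_le hxX
  have hY : 0 < Y := hX.trans_le hXY
  have hy : 0 < y := hx.trans_le hxy
  have h1 : Real.log (y / x * (X / Y)) ≤ y / x * (X / Y) - 1 :=
    Real.log_le_sub_one_of_pos (by positivity)
  have h2 : Real.log (X / Y) ≤ X / Y - 1 := Real.log_le_sub_one_of_pos (by positivity)
  rw [Real.log_mul (by positivity) (by positivity)] at h1
  have h3 : Real.log (Y / X) = -Real.log (X / Y) := by rw [← Real.log_inv, inv_div]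
  rw [h3]
  have h4 : x * (y / x * (X / Y) - 1) = y * (X / Y) - x := by field_simp
  have h5 : (y - x) * (X / Y) ≤ (Y - X) * (X / Y) :=
    mul_le_mul_of_nonneg_right h (by positivity)
  have h6 : Y * (X / Y) = X := by field_simp
  have h7 := mul_le_mul_of_nonneg_left h1 hx.le
  have h8 := mul_le_mul_of_nonneg_left h2 (sub_nonneg.2 hxX)
  nlinarith

/-- Gibbs-type inequality: `b * log (u / b) + b ≤ b * log (1 / c) + u * c`. -/
lemma mul_log_div_add_le {b u c : ℝ} (hb : 0 ≤ b) (hbu : b ≤ u) (hc : 0 < c) :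
    b * Real.log (u / b) + b ≤ b * -Real.log c + u * c := by
  rcases hb.eq_or_lt with rfl | hb
  · simpa using mul_nonneg hbu hc.le
  have hu : 0 < u := hb.trans_le hbu
  have h1 : Real.log (u / b * c) ≤ u / b * c - 1 := Real.log_le_sub_one_of_pos (by positivity)
  rw [Real.log_mul (by positivity) hc.ne'] at h1
  have h2 := mul_le_mul_of_nonneg_left h1 hb.le
  have h3 : b * (u / b * c - 1) = u * c - b := by field_simp
  linarith

lemma mul_log_div_add_self_le {a b s t c d : ℝ} (ha : 0 ≤ a) (has : a ≤ s) (hb : 0 ≤ b)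
    (hbt : b ≤ t) (hc : 0 < c) (hd : 0 < d) :
    (a + b) * Real.log ((s + t) / (a + b)) + a + b ≤
      a * Real.log (s / a) + a * -Real.log c + a / s * (s + t) * c +
        b * -Real.log d + (s + t) * d := by
  have hB : b * Real.log ((s + t) / (a + b)) ≤ b * Real.log ((s + t) / b) := by
    rcases hb.eq_or_lt with rfl | hb
    · simp
    have : 0 < s + t := by linarith
    gcongr
    linarith
  have hB' := mul_log_div_add_le hb (by linarith : b ≤ s + t) hd
  rcases ha.eq_or_lt with rfl | ha
  · simp only [zero_add, zero_mul, zero_div] at *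
    linarith
  have hs : 0 < s := ha.trans_le has
  have ht : 0 < s + t := by linarith
  have hA : a * Real.log ((s + t) / (a + b)) ≤ a * Real.log ((s + t) / a) := by
    gcongr
    linarith
  have hA' := mul_log_div_add_le hs.le (by linarith : s ≤ s + t) hc
  have h1 : Real.log ((s + t) / a) = Real.log (s / a) + Real.log ((s + t) / s) := by
    rw [← Real.log_mul (by positivity) (by positivity)]
    congr 1
    field_simp
  have h2 : a / s * (s * Real.log ((s + t) / s) + s) ≤ a / s * (s * -Real.log c + (s + t) * c) :=
    mul_le_mul_of_nonneg_left hA' (by positivity)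
  have h3 : a / s * (s * Real.log ((s + t) / s) + s) = a * Real.log ((s + t) / s) + a := by
    field_simp
  have h4 : a / s * (s * -Real.log c + (s + t) * c) =
      a * -Real.log c + a / s * (s + t) * c := by
    field_simp
  rw [h1] at hA
  rw [h3, h4] at h2
  linarith

lemma neg_log_geometric {n : ℝ} (hn : 0 < n) (i : ℕ) :
    -Real.log ((1 + n)⁻¹ * (n / (1 + n)) ^ i) =
      Real.log (1 + n) + i * Real.log ((1 + n) / n) := by
  rw [Real.log_mul (by positivity) (by positivity), Real.log_pow, Real.log_inv,
    ← inv_div (1 + n) n, Real.log_inv]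
  ring

lemma tsum_ofReal_geometric {n : ℝ} (hn : 0 < n) :
    ∑' i : ℕ, ENNReal.ofReal ((1 + n)⁻¹ * (n / (1 + n)) ^ i) = 1 := by
  have h := (hasSum_geometric_of_lt_one (r := n / (1 + n)) (by positivity)
    ((div_lt_one (by positivity)).2 (by linarith))).mul_left (1 + n)⁻¹
  rw [← ENNReal.ofReal_tsum_of_nonneg (fun i => by positivity) h.summable, h.tsum_eq,
    ENNReal.ofReal_eq_one]
  field_simp
  ring

lemma summable_section {f : ℕ × ℕ → ℝ} (hf : Summable f) (j : ℕ) :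
    Summable fun i => f (i, j) :=
  hf.comp_injective fun _ _ h => (Prod.ext_iff.1 h).1

lemma le_marg2 {f : ℕ × ℕ → ℝ} (hf0 : ∀ x, 0 ≤ f x) (hf : Summable f) (i j : ℕ) :
    f (i, j) ≤ marg2 f j :=
  (summable_section hf j).le_tsum i fun k _ => hf0 (k, j)

lemma marg2_nonneg {f : ℕ × ℕ → ℝ} (hf0 : ∀ x, 0 ≤ f x) (j : ℕ) : 0 ≤ marg2 f j :=
  tsum_nonneg fun _ => hf0 _

lemma tsum_ofReal_section {f : ℕ × ℕ → ℝ} (hf0 : ∀ x, 0 ≤ f x) (hf : Summable f) (j : ℕ) :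
    ∑' i, ENNReal.ofReal (f (i, j)) = ENNReal.ofReal (marg2 f j) :=
  (ENNReal.ofReal_tsum_of_nonneg (fun _ => hf0 _) (summable_section hf j)).symm

lemma tsum_tsum_swap (f : ℕ × ℕ → ℝ≥0∞) : ∑' j, ∑' i, f (i, j) = ∑' x, f x := by
  rw [ENNReal.tsum_comm, ENNReal.tsum_prod']

lemma condEnt_eq {f : ℕ × ℕ → ℝ} (hf0 : ∀ x, 0 ≤ f x) :
    condEnt f = ∑' j, ∑' i, ENNReal.ofReal (f (i, j) * Real.log (marg2 f j / f (i, j))) := by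
  unfold condEnt shEnt
  refine tsum_congr fun j => ?_
  rw [← ENNReal.tsum_mul_left]
  refine tsum_congr fun i => ?_
  rw [← ENNReal.ofReal_mul (marg2_nonneg hf0 j), Real.negMulLog]
  congr 1
  by_cases h : marg2 f j = 0
  · simp [h]
  · beta_reduce
    rw [← inv_div (marg2 f j), Real.log_inv]
    field_simp

/-- Comparison of conditional entropies of unnormalized distributions with `p ≤ a + b`. -/
lemma condEnt_le_add {p a b : ℕ × ℕ → ℝ} (hp0 : ∀ x, 0 ≤ p x) (hp : Summable p)
    (ha0 : ∀ x, 0 ≤ a x) (ha : Summable a) (hb0 : ∀ x, 0 ≤ b x) (hb : Summable b)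
    (hab : ∀ x, p x ≤ a x + b x) {ε n : ℝ} (hε : 0 < ε) (hn : 0 < n) :
    condEnt p ≤ condEnt a + ENNReal.ofReal (Real.log (1 + ε)) * ∑' x, ENNReal.ofReal (a x) +
      ENNReal.ofReal (Real.log ((1 + ε) / ε) + Real.log (1 + n)) * ∑' x, ENNReal.ofReal (b x) +
      ENNReal.ofReal (Real.log ((1 + n) / n)) *
        ∑' x : ℕ × ℕ, ENNReal.ofReal ((x.1 : ℝ) * b x) := by
  set G : ℕ → ℝ := fun i => (1 + n)⁻¹ * (n / (1 + n)) ^ i with hG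
  have hG0 (i : ℕ) : 0 < G i := by positivity
  set w : ℕ → ℝ := fun j => marg2 a j + marg2 b j with hw
  have hw0 (j : ℕ) : 0 ≤ w j := add_nonneg (marg2_nonneg ha0 j) (marg2_nonneg hb0 j)
  have hl1 : 0 ≤ Real.log (1 + ε) := Real.log_nonneg (by linarith)
  have hl2 : 0 ≤ Real.log ((1 + ε) / ε) := Real.log_nonneg ((one_le_div hε).2 (by linarith))
  have hl3 : 0 ≤ Real.log (1 + n) := Real.log_nonneg (by linarith)
  have hl4 : 0 ≤ Real.log ((1 + n) / n) := Real.log_nonneg ((one_le_div hn).2 (by linarith))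
  have hent0 {f : ℕ × ℕ → ℝ} (hf0 : ∀ x, 0 ≤ f x) (hf : Summable f) (i j : ℕ) :
      0 ≤ f (i, j) * Real.log (marg2 f j / f (i, j)) := by
    rcases (hf0 (i, j)).eq_or_lt with h | h
    · simp [← h]
    · exact mul_nonneg h.le (Real.log_nonneg ((one_le_div h).2 (le_marg2 hf0 hf i j)))
  have hpt (j i : ℕ) :
      ENNReal.ofReal (p (i, j) * Real.log (marg2 p j / p (i, j))) +
          ENNReal.ofReal (a (i, j)) + ENNReal.ofReal (b (i, j)) ≤
        ENNReal.ofReal (a (i, j) * Real.log (marg2 a j / a (i, j))) +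
          ENNReal.ofReal (Real.log (1 + ε)) * ENNReal.ofReal (a (i, j)) +
          ENNReal.ofReal (1 + ε)⁻¹ *
            (ENNReal.ofReal (w j) * ENNReal.ofReal (a (i, j) / marg2 a j)) +
          ENNReal.ofReal (Real.log ((1 + ε) / ε) + Real.log (1 + n)) *
            ENNReal.ofReal (b (i, j)) +
          ENNReal.ofReal (Real.log ((1 + n) / n)) * ENNReal.ofReal ((i : ℝ) * b (i, j)) +
          ENNReal.ofReal (ε / (1 + ε)) * (ENNReal.ofReal (w j) * ENNReal.ofReal (G i)) := by
    have hai := ha0 (i, j)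
    have hbi := hb0 (i, j)
    have hms := marg2_nonneg ha0 j
    have hwj := hw0 j
    have hGi := hG0 i
    have hpe := hent0 hp0 hp i j
    have hae := hent0 ha0 ha i j
    rw [← ENNReal.ofReal_add (by positivity) (by positivity),
      ← ENNReal.ofReal_add (by positivity) (by positivity)]
    simp only [← ENNReal.ofReal_mul hwj]
    rw [← ENNReal.ofReal_mul (by positivity), ← ENNReal.ofReal_mul (by positivity),
      ← ENNReal.ofReal_mul (by positivity), ← ENNReal.ofReal_mul (by positivity),
      ← ENNReal.ofReal_mul (by positivity),
      ← ENNReal.ofReal_add (by positivity) (by positivity),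
      ← ENNReal.ofReal_add (by positivity) (by positivity),
      ← ENNReal.ofReal_add (by positivity) (by positivity),
      ← ENNReal.ofReal_add (by positivity) (by positivity),
      ← ENNReal.ofReal_add (by positivity) (by positivity)]
    refine ENNReal.ofReal_le_ofReal ?_
    have hrow : marg2 p j - p (i, j) ≤ marg2 a j + marg2 b j - (a (i, j) + b (i, j)) := by
      have h := le_marg2 (f := fun x => a x + b x - p x) (fun x => sub_nonneg.2 (hab x))
        ((ha.add hb).sub hp) i j
      have h' : marg2 (fun x => a x + b x - p x) j = marg2 a j + marg2 b j - marg2 p j := by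
        unfold marg2
        rw [((summable_section ha j).add (summable_section hb j)).tsum_sub
          (summable_section hp j), (summable_section ha j).tsum_add (summable_section hb j)]
      rw [h'] at h
      linarith
    have h1 := mul_log_div_le_mul_log_div (hp0 (i, j)) (hab (i, j)) (le_marg2 hp0 hp i j) hrow
    have h2 := mul_log_div_add_self_le (c := (1 + ε)⁻¹) (d := ε / (1 + ε) * G i) hai
      (le_marg2 ha0 ha i j) hbi (le_marg2 hb0 hb i j) (by positivity) (by positivity)
    rw [Real.log_mul (by positivity) hGi.ne', neg_add, neg_log_geometric hn i,
      ← Real.log_inv (ε / (1 + ε)), inv_div, Real.log_inv, neg_neg] at h2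
    simp only [hw]
    linarith
  have hsum := ENNReal.tsum_le_tsum fun j => ENNReal.tsum_le_tsum (hpt j)
  simp only [ENNReal.tsum_add, ENNReal.tsum_mul_left, tsum_ofReal_geometric hn, hG, mul_one]
    at hsum
  rw [← condEnt_eq hp0, ← condEnt_eq ha0, tsum_tsum_swap fun x => ENNReal.ofReal (a x),
    tsum_tsum_swap fun x => ENNReal.ofReal (b x),
    tsum_tsum_swap fun x => ENNReal.ofReal ((x.1 : ℝ) * b x)] at hsum
  have hfin {f : ℕ × ℕ → ℝ} (hf0 : ∀ x, 0 ≤ f x) (hf : Summable f) :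
      ∑' x, ENNReal.ofReal (f x) ≠ ∞ := by
    rw [← ENNReal.ofReal_tsum_of_nonneg hf0 hf]
    exact ENNReal.ofReal_ne_top
  have hwsum : ∑' j, ENNReal.ofReal (w j) =
      ∑' x, ENNReal.ofReal (a x) + ∑' x, ENNReal.ofReal (b x) := by
    simp only [hw, ENNReal.ofReal_add (marg2_nonneg ha0 _) (marg2_nonneg hb0 _),
      ENNReal.tsum_add, ← tsum_ofReal_section ha0 ha, ← tsum_ofReal_section hb0 hb,
      tsum_tsum_swap fun x => ENNReal.ofReal (a x), tsum_tsum_swap fun x => ENNReal.ofReal (b x)]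
  have hcond : ∑' j, ENNReal.ofReal (w j) * ∑' i, ENNReal.ofReal (a (i, j) / marg2 a j) ≤
      ∑' j, ENNReal.ofReal (w j) := by
    refine ENNReal.tsum_le_tsum fun j => mul_le_of_le_one_right' ?_
    rw [← ENNReal.ofReal_tsum_of_nonneg
      (fun i => div_nonneg (ha0 _) (marg2_nonneg ha0 j)) ((summable_section ha j).div_const _),
      tsum_div_const]
    exact ENNReal.ofReal_le_one.2 (div_self_le_one _)
  have hcoef : ENNReal.ofReal (1 + ε)⁻¹ + ENNReal.ofReal (ε / (1 + ε)) = 1 := by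
    rw [← ENNReal.ofReal_add (by positivity) (by positivity), ENNReal.ofReal_eq_one]
    field_simp
  have hAfin := hfin ha0 ha
  have hBfin := hfin hb0 hb
  set A := ∑' x, ENNReal.ofReal (a x)
  set B := ∑' x, ENNReal.ofReal (b x)
  rw [add_assoc] at hsum
  refine (ENNReal.add_le_add_iff_right (ENNReal.add_ne_top.2 ⟨hAfin, hBfin⟩)).1
    (hsum.trans ?_)
  calc _ ≤ condEnt a + ENNReal.ofReal (Real.log (1 + ε)) * A +
          ENNReal.ofReal (1 + ε)⁻¹ * ∑' j, ENNReal.ofReal (w j) +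
          ENNReal.ofReal (Real.log ((1 + ε) / ε) + Real.log (1 + n)) * B +
          ENNReal.ofReal (Real.log ((1 + n) / n)) *
            ∑' x : ℕ × ℕ, ENNReal.ofReal ((x.1 : ℝ) * b x) +
          ENNReal.ofReal (ε / (1 + ε)) * ∑' j, ENNReal.ofReal (w j) := by
        gcongr
    _ = condEnt a + ENNReal.ofReal (Real.log (1 + ε)) * A +
          ENNReal.ofReal (Real.log ((1 + ε) / ε) + Real.log (1 + n)) * B +
          ENNReal.ofReal (Real.log ((1 + n) / n)) *
            ∑' x : ℕ × ℕ, ENNReal.ofReal ((x.1 : ℝ) * b x) +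
          (ENNReal.ofReal (1 + ε)⁻¹ + ENNReal.ofReal (ε / (1 + ε))) * (A + B) := by
        rw [hwsum]
        ring
    _ = _ := by rw [hcoef, one_mul]

lemma condEnt_ne_top {p : ℕ × ℕ → ℝ} (hp : IsProbDist p) {t : ℝ}
    (hpt : ∑' x : ℕ × ℕ, ENNReal.ofReal ((x.1 : ℝ) * p x) ≤ ENNReal.ofReal t) :
    condEnt p ≠ ∞ := by
  have h := condEnt_le_add (a := fun _ => 0) hp.1 hp.2.summable (fun _ => le_rfl) summable_zero
    hp.1 hp.2.summable (fun x => by simp) one_pos one_pos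
  have h0 : condEnt (fun _ => 0) = 0 := by simp [condEnt, marg2]
  have h1 : ∑' x, ENNReal.ofReal (p x) = 1 := by
    rw [← ENNReal.ofReal_tsum_of_nonneg hp.1 hp.2.summable, hp.2.tsum_eq, ENNReal.ofReal_one]
  rw [h0, h1] at h
  refine ne_top_of_le_ne_top ?_ h
  have := ENNReal.mul_ne_top (ENNReal.ofReal_ne_top (r := Real.log ((1 + 1) / 1)))
    (ne_top_of_le_ne_top ENNReal.ofReal_ne_top hpt)
  exact ENNReal.add_ne_top.2 ⟨by simp, this⟩

lemma condEnt_toReal_sub_le {p q : ℕ × ℕ → ℝ} (hp : IsProbDist p) (hq : IsProbDist q)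
    (hqtop : condEnt q ≠ ∞) {t : ℝ} (ht : 0 < t)
    (hpt : ∑' x : ℕ × ℕ, ENNReal.ofReal ((x.1 : ℝ) * p x) ≤ ENNReal.ofReal t)
    {ε : ℝ} (hε : 0 < ε) (hTV : TVd p q ≤ ε) :
    (condEnt p).toReal - (condEnt q).toReal ≤ ε * gFun (t / ε) + gFun ε := by
  have hd : Summable fun x => p x - q x := hp.2.summable.sub hq.2.summable
  have hb_eq (x : ℕ × ℕ) : max (p x - q x) 0 = 1 / 2 * (|p x - q x| + (p x - q x)) := by
    rcases le_total (p x - q x) 0 with h | h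
    · rw [max_eq_right h, abs_of_nonpos h]; ring
    · rw [max_eq_left h, abs_of_nonneg h]; ring
  have hb : Summable fun x => max (p x - q x) 0 := by
    simp only [hb_eq]
    exact (hd.abs.add hd).mul_left _
  have hbsum : ∑' x, max (p x - q x) 0 = TVd p q := by
    simp only [hb_eq, TVd]
    rw [tsum_mul_left, hd.abs.tsum_add hd, hp.2.summable.tsum_sub hq.2.summable, hp.2.tsum_eq,
      hq.2.tsum_eq]
    ring
  have hB : ∑' x, ENNReal.ofReal (max (p x - q x) 0) ≤ ENNReal.ofReal ε := by
    rw [← ENNReal.ofReal_tsum_of_nonneg (fun x => le_max_right _ _) hb, hbsum]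
    exact ENNReal.ofReal_le_ofReal hTV
  have hA : ∑' x, ENNReal.ofReal (q x) = 1 := by
    rw [← ENNReal.ofReal_tsum_of_nonneg hq.1 hq.2.summable, hq.2.tsum_eq, ENNReal.ofReal_one]
  have hM : ∑' x : ℕ × ℕ, ENNReal.ofReal ((x.1 : ℝ) * max (p x - q x) 0) ≤ ENNReal.ofReal t := by
    refine le_trans (ENNReal.tsum_le_tsum fun x => ENNReal.ofReal_le_ofReal ?_) hpt
    have := hq.1 x
    exact mul_le_mul_of_nonneg_left (max_le (by linarith) (hp.1 x)) (Nat.cast_nonneg _)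
  have hn : 0 < t / ε := by positivity
  have h := condEnt_le_add hp.1 hp.2.summable hq.1 hq.2.summable (fun x => le_max_right _ _) hb
    (fun x => by linarith [le_max_left (p x - q x) 0]) hε hn
  have hl1 : 0 ≤ Real.log (1 + ε) := Real.log_nonneg (by linarith)
  have hl2 : 0 ≤ Real.log ((1 + ε) / ε) := Real.log_nonneg ((one_le_div hε).2 (by linarith))
  have hl3 : 0 ≤ Real.log (1 + t / ε) := Real.log_nonneg (by linarith)
  have hl4 : 0 ≤ Real.log ((1 + t / ε) / (t / ε)) :=
    Real.log_nonneg ((one_le_div hn).2 (by linarith))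
  have hC : ε * gFun (t / ε) + gFun ε = Real.log (1 + ε) +
      (Real.log ((1 + ε) / ε) + Real.log (1 + t / ε)) * ε +
      Real.log ((1 + t / ε) / (t / ε)) * t := by
    rw [Real.log_div (by positivity) hε.ne', Real.log_div (by positivity) hn.ne', gFun, gFun,
      add_comm (t / ε) 1, add_comm ε 1]
    have : t = ε * (t / ε) := by field_simp
    generalize t / ε = n at *
    rw [this]
    ring
  have hC0 : 0 ≤ ε * gFun (t / ε) + gFun ε := by rw [hC]; positivity
  have hle : condEnt p ≤ condEnt q + ENNReal.ofReal (ε * gFun (t / ε) + gFun ε) := by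
    rw [hC, ENNReal.ofReal_add (by positivity) (by positivity),
      ENNReal.ofReal_add (by positivity) (by positivity), ENNReal.ofReal_mul (by positivity),
      ENNReal.ofReal_mul hl4, ← add_assoc, ← add_assoc]
    refine h.trans ?_
    rw [hA, mul_one]
    gcongr
  have h' := ENNReal.toReal_mono (ENNReal.add_ne_top.2 ⟨hqtop, ENNReal.ofReal_ne_top⟩) hle
  rw [ENNReal.toReal_add hqtop ENNReal.ofReal_ne_top, ENNReal.toReal_ofReal hC0] at h'
  linarith

lemma TVd_comm {α : Type*} (p q : α → ℝ) : TVd p q = TVd q p := by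
  simp only [TVd, abs_sub_comm]

/-- **Two-sided continuity bound for the conditional Shannon entropy under mean
(energy-type) constraints**: if `∑_{i,j} i·p(i,j) ≤ t_p` and
`∑_{i,j} i·q(i,j) ≤ t_q`, then for `TV(p,q) ≤ ε ≤ 1`,
`−(ε·g(t_q/ε) + g(ε)) ≤ H(X₁|X₂)_p − H(X₁|X₂)_q ≤ ε·g(t_p/ε) + g(ε)`. -/
theorem condEntropy_energy_two_side_bound
    (p : ℕ × ℕ → ℝ) (hp : IsProbDist p)
    (q : ℕ × ℕ → ℝ) (hq : IsProbDist q)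
    (tp tq : ℝ) (htp : 0 < tp) (htq : 0 < tq)
    (hpt : ∑' x : ℕ × ℕ, ENNReal.ofReal ((x.1 : ℝ) * p x) ≤ ENNReal.ofReal tp)
    (hqt : ∑' x : ℕ × ℕ, ENNReal.ofReal ((x.1 : ℝ) * q x) ≤ ENNReal.ofReal tq)
    (ε : ℝ) (hε0 : 0 < ε) (hε1 : ε ≤ 1) (hTV : TVd p q ≤ ε) :
    ((-(ε * gFun (tq / ε) + gFun ε) : ℝ) : EReal) ≤
        (condEnt p : EReal) - (condEnt q : EReal) ∧
    (condEnt p : EReal) - (condEnt q : EReal) ≤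
        ((ε * gFun (tp / ε) + gFun ε : ℝ) : EReal) := by
  have hpf := condEnt_ne_top hp hpt
  have hqf := condEnt_ne_top hq hqt
  have h1 := condEnt_toReal_sub_le hp hq hqf htp hpt hε0 hTV
  have h2 := condEnt_toReal_sub_le hq hp hpf htq hqt hε0 (TVd_comm p q ▸ hTV)
  rw [← EReal.coe_ennreal_toReal hpf, ← EReal.coe_ennreal_toReal hqf, ← EReal.coe_sub,
    EReal.coe_le_coe_iff, EReal.coe_le_coe_iff]
  exact ⟨by linarith, h1⟩
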